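/- Let p ≥ 3 be a prime, q a power of p, and F a finite field with q elements. Let N be the group of F-algebra automorphisms σ of F⟦X⟧ with σ(X) − X ∈ (X²), and for n ≥ 1 let K_n = { σ ∈ N : σ(X) − X ∈ (X^{n+1}) }, a finite-index normal subgroup of N. Let S ⊆ N be a finite symmetric subset (S = S⁻¹) whose image in N/K_n generates N/K_n for every n ≥ 1. Then there exists a real constant C > 0 such that for every C' > 0 there exist real constants C'', C''' > 0 with the following property: for every n ≥ 2, every element x of the finite group N/K_n, and every natural number l ≥ C''·n^{C+C'}, one has |ν^{*l}(x) − 1/|N/K_n|| ≤ exp(−C'''·n^{C'}), where ν : N/K_n → ℝ is defined by ν(y) = |{ s ∈ S : s·K_n = y }|/|S| and ν^{*l} is the l-fold convolution of ν with itself, with convolution (φ*ψ)(g) = Σ_{h} φ(h)ψ(h⁻¹g). -/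

import Mathlib

open PowerSeries

section Nottingham

variable {F : Type*} [Field F]

private lemma X_dvd_algEquiv_X (σ : PowerSeries F ≃ₐ[F] PowerSeries F) :
    (PowerSeries.X : PowerSeries F) ∣ σ PowerSeries.X := by
  rw [PowerSeries.X_dvd_iff]
  by_contra h
  have hu : IsUnit (σ (PowerSeries.X : PowerSeries F)) := by
    rw [PowerSeries.isUnit_iff_constantCoeff]
    exact isUnit_iff_ne_zero.mpr h
  have hX : IsUnit (PowerSeries.X : PowerSeries F) := by
    have := hu.map (σ.symm : PowerSeries F →+* PowerSeries F)
    simpa using this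
  rw [PowerSeries.isUnit_iff_constantCoeff] at hX
  simp at hX

private lemma algEquiv_mem_span_pow (σ : PowerSeries F ≃ₐ[F] PowerSeries F)
    (k : ℕ) {f : PowerSeries F}
    (hf : f ∈ Ideal.span {(PowerSeries.X : PowerSeries F) ^ k}) :
    σ f ∈ Ideal.span {(PowerSeries.X : PowerSeries F) ^ k} := by
  rw [Ideal.mem_span_singleton] at hf ⊢
  obtain ⟨c, rfl⟩ := hf
  rw [map_mul, map_pow]
  exact Dvd.dvd.mul_right (pow_dvd_pow_of_dvd (X_dvd_algEquiv_X σ) k) _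

/-- The Nottingham group of the field `F`: the group of `F`-algebra automorphisms
`σ` of `F⟦X⟧` such that `σ X − X ∈ (X²)`. -/
def NottinghamGroup (F : Type*) [Field F] :
    Subgroup (PowerSeries F ≃ₐ[F] PowerSeries F) where
  carrier := {σ | σ PowerSeries.X - PowerSeries.X ∈
    Ideal.span {(PowerSeries.X : PowerSeries F) ^ 2}}
  one_mem' := by simp
  mul_mem' := by
    intro σ τ hσ hτ
    have h : (σ * τ) (PowerSeries.X : PowerSeries F) - PowerSeries.X =
        (σ (τ PowerSeries.X) - σ PowerSeries.X) + (σ PowerSeries.X - PowerSeries.X) := by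
      rw [AlgEquiv.mul_apply]; ring
    rw [Set.mem_setOf_eq, h]
    refine add_mem ?_ hσ
    rw [← map_sub]
    exact algEquiv_mem_span_pow σ 2 hτ
  inv_mem' := by
    intro σ hσ
    have h : σ⁻¹ (PowerSeries.X : PowerSeries F) - PowerSeries.X =
        -(σ.symm (σ PowerSeries.X - PowerSeries.X)) := by
      rw [map_sub, AlgEquiv.symm_apply_apply]
      show σ.symm (PowerSeries.X : PowerSeries F) - PowerSeries.X = _
      ring
    rw [Set.mem_setOf_eq, h]
    exact neg_mem (algEquiv_mem_span_pow σ.symm 2 hσ)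

/-- The `n`-th congruence subgroup of the Nottingham group: automorphisms `σ`
with `σ X − X ∈ (X^(n+1))`. -/
def NottinghamCong (F : Type*) [Field F] (n : ℕ) : Subgroup (NottinghamGroup F) where
  carrier := {σ | (σ : PowerSeries F ≃ₐ[F] PowerSeries F) PowerSeries.X - PowerSeries.X ∈
    Ideal.span {(PowerSeries.X : PowerSeries F) ^ (n + 1)}}
  one_mem' := by simp
  mul_mem' := by
    intro σ τ hσ hτ
    have hcoe : ((σ * τ : NottinghamGroup F) : PowerSeries F ≃ₐ[F] PowerSeries F) =
        (σ : PowerSeries F ≃ₐ[F] PowerSeries F) * (τ : PowerSeries F ≃ₐ[F] PowerSeries F) :=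
      rfl
    have h : ((σ * τ : NottinghamGroup F) : PowerSeries F ≃ₐ[F] PowerSeries F)
          (PowerSeries.X : PowerSeries F) - PowerSeries.X =
        ((σ : PowerSeries F ≃ₐ[F] PowerSeries F)
            ((τ : PowerSeries F ≃ₐ[F] PowerSeries F) PowerSeries.X) -
          (σ : PowerSeries F ≃ₐ[F] PowerSeries F) PowerSeries.X) +
        ((σ : PowerSeries F ≃ₐ[F] PowerSeries F) PowerSeries.X - PowerSeries.X) := by
      rw [hcoe, AlgEquiv.mul_apply]; ring
    rw [Set.mem_setOf_eq, h]
    refine add_mem ?_ hσ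
    rw [← map_sub]
    exact algEquiv_mem_span_pow _ (n + 1) hτ
  inv_mem' := by
    intro σ hσ
    have hcoe : ((σ⁻¹ : NottinghamGroup F) : PowerSeries F ≃ₐ[F] PowerSeries F) =
        ((σ : PowerSeries F ≃ₐ[F] PowerSeries F))⁻¹ := rfl
    have h : ((σ⁻¹ : NottinghamGroup F) : PowerSeries F ≃ₐ[F] PowerSeries F)
          (PowerSeries.X : PowerSeries F) - PowerSeries.X =
        -((σ : PowerSeries F ≃ₐ[F] PowerSeries F).symm
          ((σ : PowerSeries F ≃ₐ[F] PowerSeries F) PowerSeries.X - PowerSeries.X)) := by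
      rw [map_sub, AlgEquiv.symm_apply_apply, hcoe]
      show (σ : PowerSeries F ≃ₐ[F] PowerSeries F).symm (PowerSeries.X : PowerSeries F) -
        PowerSeries.X = _
      ring
    rw [Set.mem_setOf_eq, h]
    exact neg_mem (algEquiv_mem_span_pow _ (n + 1) hσ)

end Nottingham

section WalkAux

open scoped Pointwise

/-- averaging operator -/
noncomputable def wkA {G ι : Type*} [Group G] [Fintype ι] (φ : ι → G) (h : G → ℝ) : G → ℝ :=
  fun x => (∑ s, h ((φ s)⁻¹ * x)) / (Fintype.card ι : ℝ)

/-- energy -/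
noncomputable def wkE {G : Type*} [Group G] [Fintype G] (h : G → ℝ) (g : G) : ℝ :=
  ∑ x, (h x - h (g * x)) ^ 2

variable {G ι : Type*} [Group G] [Fintype G] [Fintype ι]

lemma wk_sum_shift (h : G → ℝ) (g : G) : ∑ x, h (g * x) = ∑ x, h x :=
  Fintype.sum_equiv (Equiv.mulLeft g) _ _ (fun _ => rfl)

lemma wkE_eq (h : G → ℝ) (g : G) :
    wkE h g = 2 * ∑ x, h x ^ 2 - 2 * ∑ x, h x * h (g * x) := by
  unfold wkE
  have h2 := wk_sum_shift (fun x => h x ^ 2) g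
  have : ∀ x, (h x - h (g * x)) ^ 2 = h x ^ 2 + h (g * x) ^ 2 - 2 * (h x * h (g * x)) := by
    intro x; ring
  simp_rw [this]
  rw [Finset.sum_sub_distrib, Finset.sum_add_distrib, h2, ← Finset.mul_sum]
  ring

lemma wkE_nonneg (h : G → ℝ) (g : G) : 0 ≤ wkE h g :=
  Finset.sum_nonneg fun _ _ => sq_nonneg _

lemma wkE_pow (h : G → ℝ) (T : Set G) (M : ℝ) (hM : ∀ t ∈ T, wkE h t ≤ M) :
    ∀ (d : ℕ) (g : G), g ∈ T ^ d → wkE h g ≤ (d : ℝ) ^ 2 * M := by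
  intro d
  induction d with
  | zero =>
    intro g hg
    rw [pow_zero, Set.mem_one] at hg
    subst hg
    simp [wkE]
  | succ d ih =>
    intro g hg
    rw [pow_succ] at hg
    obtain ⟨w, hw, t, ht, rfl⟩ := Set.mem_mul.1 hg
    have h1 := ih w hw
    have h2 := hM t ht
    rcases Nat.eq_zero_or_pos d with hd | hd
    · subst hd
      rw [pow_zero, Set.mem_one] at hw
      subst hw
      simpa using h2
    have hd' : (0 : ℝ) < d := by exact_mod_cast hd
    have key : (d : ℝ) * wkE h (w * t) ≤ (d + 1) * wkE h w + d * (1 + d) * wkE h t := by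
      have e1 : wkE h w = ∑ x, (h (t * x) - h (w * (t * x))) ^ 2 :=
        (wk_sum_shift (fun x => (h x - h (w * x)) ^ 2) t).symm
      rw [e1]
      unfold wkE
      rw [Finset.mul_sum, Finset.mul_sum, Finset.mul_sum, ← Finset.sum_add_distrib]
      apply Finset.sum_le_sum
      intro x _
      rw [mul_assoc w t x]
      generalize h (w * (t * x)) = c
      generalize h (t * x) = b
      nlinarith [sq_nonneg ((b - c) - d * (h x - b))]
    have : (d : ℝ) * wkE h (w * t) ≤ d * (((d + 1 : ℕ) : ℝ) ^ 2 * M) := by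
      push_cast
      calc _ ≤ _ := key
        _ ≤ (d + 1) * ((d : ℝ) ^ 2 * M) + d * (1 + d) * M := by gcongr
        _ = _ := by ring
    exact le_of_mul_le_mul_left this hd'

lemma wkE_sum (h : G → ℝ) (h0 : ∑ x, h x = 0) :
    ∑ g, wkE h g = 2 * Fintype.card G * ∑ x, h x ^ 2 := by
  simp_rw [wkE_eq]
  have e : ∑ g, ∑ x, h x * h (g * x) = ∑ x, ∑ g, h x * h (g * x) := Finset.sum_comm
  rw [Finset.sum_sub_distrib, ← Finset.mul_sum (f := fun g => ∑ x, h x * h (g * x)), e]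
  have : ∀ x : G, ∑ g, h x * h (g * x) = 0 := by
    intro x
    rw [← Finset.mul_sum, Fintype.sum_equiv (Equiv.mulRight x) (fun g => h (g * x)) h
      (fun _ => rfl), h0, mul_zero]
  simp_rw [this]
  simp
  ring

lemma wkA_sq [Nonempty ι] (φ : ι → G) (h : G → ℝ) :
    ∑ x, (wkA φ h x) ^ 2 = ∑ x, h x ^ 2 -
      (∑ s, ∑ t, wkE h ((φ t)⁻¹ * φ s)) / (2 * (Fintype.card ι : ℝ) ^ 2) := by
  have hk : (Fintype.card ι : ℝ) ≠ 0 := by exact_mod_cast Fintype.card_ne_zero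
  simp_rw [wkE_eq]
  have h1 : ∀ s t, ∑ x, h x * h ((φ t)⁻¹ * φ s * x) =
      ∑ x, h ((φ s)⁻¹ * x) * h ((φ t)⁻¹ * x) := by
    intro s t
    rw [← wk_sum_shift (fun x => h x * h ((φ t)⁻¹ * φ s * x)) (φ s)⁻¹]
    apply Finset.sum_congr rfl
    intro x _
    congr 2
    group
  simp_rw [h1]
  have h2 : ∑ x, (wkA φ h x) ^ 2 =
      (∑ s, ∑ t, ∑ x, h ((φ s)⁻¹ * x) * h ((φ t)⁻¹ * x)) / (Fintype.card ι : ℝ) ^ 2 := by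
    unfold wkA
    simp_rw [div_pow]
    rw [← Finset.sum_div]
    congr 1
    simp_rw [sq, Finset.sum_mul_sum]
    rw [Finset.sum_comm]
    apply Finset.sum_congr rfl
    intro s _
    rw [Finset.sum_comm]
  rw [h2]
  simp_rw [Finset.sum_sub_distrib, ← Finset.mul_sum]
  simp only [Finset.sum_const, Finset.card_univ, nsmul_eq_mul]
  field_simp
  ring

lemma wkA_contract [Nonempty ι] (φ : ι → G) (h : G → ℝ) (h0 : ∑ x, h x = 0) (d : ℕ)
    (hd : 0 < d)
    (hT : ∀ g : G, g ∈ ({t : G | ∃ a b, t = (φ b)⁻¹ * φ a} ^ d : Set G)) :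
    ∑ x, (wkA φ h x) ^ 2 ≤
      (1 - 1 / ((d : ℝ) ^ 2 * (Fintype.card ι : ℝ) ^ 2)) * ∑ x, h x ^ 2 := by
  have hk : (0 : ℝ) < (Fintype.card ι : ℝ) := by exact_mod_cast Fintype.card_pos
  have hd' : (0 : ℝ) < d := by exact_mod_cast hd
  have hG : (0 : ℝ) < (Fintype.card G : ℝ) := by exact_mod_cast Fintype.card_pos
  rw [wkA_sq]
  set M := ∑ s, ∑ t, wkE h ((φ t)⁻¹ * φ s) with hM
  have hE := wkE_pow h {t : G | ∃ a b, t = (φ b)⁻¹ * φ a} M (by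
    rintro _ ⟨a, b, rfl⟩
    calc wkE h ((φ b)⁻¹ * φ a) ≤ ∑ t, wkE h ((φ t)⁻¹ * φ a) :=
          Finset.single_le_sum (f := fun t => wkE h ((φ t)⁻¹ * φ a))
            (fun _ _ => wkE_nonneg _ _) (Finset.mem_univ b)
      _ ≤ M := Finset.single_le_sum (f := fun a => ∑ t, wkE h ((φ t)⁻¹ * φ a))
            (fun _ _ => Finset.sum_nonneg fun _ _ => wkE_nonneg _ _) (Finset.mem_univ a)) d
  have h1 : ∑ g, wkE h g ≤ Fintype.card G * ((d : ℝ) ^ 2 * M) := by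
    have := Finset.sum_le_sum (s := Finset.univ) (fun g _ => hE g (hT g))
    simpa using this
  rw [wkE_sum h h0] at h1
  have h2 : 2 * ∑ x, h x ^ 2 ≤ (d : ℝ) ^ 2 * M := by
    nlinarith
  rw [sub_mul, one_mul]
  apply sub_le_sub_left
  rw [div_mul_eq_mul_div, one_mul, div_le_div_iff₀ (by positivity) (by positivity)]
  nlinarith [mul_le_mul_of_nonneg_right h2 (sq_nonneg (Fintype.card ι : ℝ))]

lemma wkA_sum [Nonempty ι] (φ : ι → G) (h : G → ℝ) : ∑ x, wkA φ h x = ∑ x, h x := by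
  have hk : (Fintype.card ι : ℝ) ≠ 0 := by exact_mod_cast Fintype.card_ne_zero
  unfold wkA
  rw [← Finset.sum_div, Finset.sum_comm]
  simp_rw [wk_sum_shift]
  simp

open Classical in
/-- law of the walk at time `l` -/
noncomputable def wkP (φ : ι → G) (l : ℕ) (x : G) : ℝ :=
  ((Finset.univ.filter fun f : Fin l → ι =>
    (List.ofFn fun i => φ (f i)).prod = x).card : ℝ) / ((Fintype.card ι : ℝ) ^ l)

lemma wkP_succ (φ : ι → G) (l : ℕ) : wkP φ (l + 1) = wkA φ (wkP φ l) := by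
  classical
  funext x
  unfold wkA wkP
  rw [← Finset.sum_div, div_div, ← pow_succ]
  congr 1
  rw [← Nat.cast_sum]
  congr 1
  simp_rw [Finset.card_filter]
  rw [← (Fin.consEquiv (fun _ : Fin (l + 1) => ι)).sum_comp, Fintype.sum_prod_type]
  apply Finset.sum_congr rfl
  intro s _
  apply Finset.sum_congr rfl
  intro f _
  simp [Fin.consEquiv, List.ofFn_succ, eq_inv_mul_iff_mul_eq]

lemma wk_main [Nonempty ι] (φ : ι → G) (d : ℕ) (hd : 0 < d)
    (hT : ∀ g : G, g ∈ ({t : G | ∃ a b, t = (φ b)⁻¹ * φ a} ^ d : Set G)) (l : ℕ) (x : G) :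
    |wkP φ l x - (Fintype.card G : ℝ)⁻¹| ≤
      Real.exp (- ((l : ℝ) / (2 * ((d : ℝ) ^ 2 * (Fintype.card ι : ℝ) ^ 2)))) := by
  classical
  have hk : (1 : ℝ) ≤ (Fintype.card ι : ℝ) := by
    exact_mod_cast Nat.one_le_iff_ne_zero.2 Fintype.card_ne_zero
  have hd' : (1 : ℝ) ≤ d := by exact_mod_cast hd
  have hG : (0 : ℝ) < (Fintype.card G : ℝ) := by exact_mod_cast Fintype.card_pos
  set c : ℝ := (d : ℝ) ^ 2 * (Fintype.card ι : ℝ) ^ 2 with hc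
  have hc1 : 1 ≤ c := by
    have := one_le_pow₀ hd' (n := 2)
    have := one_le_pow₀ hk (n := 2)
    nlinarith
  have hr0 : 0 ≤ 1 - 1 / c := by
    rw [sub_nonneg, div_le_one (by linarith)]; exact hc1
  have main : ∀ l, ∑ x, (wkP φ l x - (Fintype.card G : ℝ)⁻¹) = 0 ∧
      ∑ x, (wkP φ l x - (Fintype.card G : ℝ)⁻¹) ^ 2 ≤ (1 - 1 / c) ^ l := by
    intro l
    induction l with
    | zero =>
      have h0 : ∀ x, wkP φ 0 x = if x = 1 then 1 else 0 := by
        intro x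
        unfold wkP
        by_cases hx : x = 1
        · subst hx; simp
        · simp [hx, Ne.symm hx]
      constructor
      · simp_rw [h0]
        simp
      · simp_rw [h0, sub_sq]
        simp [Finset.sum_add_distrib]
        field_simp
        linarith
    | succ l ih =>
      have e : ∀ x, wkP φ (l + 1) x - (Fintype.card G : ℝ)⁻¹ =
          wkA φ (fun x => wkP φ l x - (Fintype.card G : ℝ)⁻¹) x := by
        intro x
        rw [wkP_succ]
        unfold wkA
        rw [Finset.sum_sub_distrib]
        simp
        field_simp
      simp_rw [e]
      refine ⟨by rw [wkA_sum]; exact ih.1, ?_⟩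
      refine (wkA_contract φ _ ih.1 d hd hT).trans ?_
      rw [pow_succ, mul_comm]
      exact mul_le_mul_of_nonneg_right ih.2 hr0
  have h1 : (wkP φ l x - (Fintype.card G : ℝ)⁻¹) ^ 2 ≤ (1 - 1 / c) ^ l :=
    (Finset.single_le_sum (f := fun x => (wkP φ l x - (Fintype.card G : ℝ)⁻¹) ^ 2)
      (fun _ _ => sq_nonneg _) (Finset.mem_univ x)).trans (main l).2
  have h2 : (1 - 1 / c) ^ l ≤ (Real.exp (-((l : ℝ) / (2 * c)))) ^ 2 := by
    have : 1 - 1 / c ≤ Real.exp (-(1 / c)) := by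
      have := Real.add_one_le_exp (-(1 / c)); linarith
    calc _ ≤ (Real.exp (-(1 / c))) ^ l := pow_le_pow_left₀ hr0 this l
      _ = _ := by
        rw [← Real.exp_nat_mul, ← Real.exp_nat_mul]
        congr 1
        push_cast
        field_simp
  exact abs_le_of_sq_le_sq (h1.trans h2) (Real.exp_pos _).le

end WalkAux
section NottAlg

variable {F : Type*} [Field F]

lemma nt_pow_dvd (σ : F⟦X⟧ ≃ₐ[F] F⟦X⟧) {k : ℕ} {f : F⟦X⟧} (hf : X ^ k ∣ f) : X ^ k ∣ σ f := by
  have := algEquiv_mem_span_pow σ k (f := f) (by rwa [Ideal.mem_span_singleton])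
  rwa [Ideal.mem_span_singleton] at this

lemma nt_mem {n : ℕ} {σ : NottinghamGroup F} :
    σ ∈ NottinghamCong F n ↔ (X : F⟦X⟧) ^ (n + 1) ∣ σ.1 X - X :=
  Ideal.mem_span_singleton

lemma nt_base {i : ℕ} {σ : F⟦X⟧ ≃ₐ[F] F⟦X⟧} (h : (X : F⟦X⟧) ^ (i + 1) ∣ σ X - X) (g : F⟦X⟧) :
    X ^ (i + 1) ∣ σ g - g := by
  have key : ∀ t, t ≤ i + 1 → ∀ g : F⟦X⟧, X ^ t ∣ σ g - g := by
    intro t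
    induction t with
    | zero => intro _ g; simp
    | succ t ih =>
      intro ht g
      obtain ⟨g1, hg1⟩ : X ∣ g - C (constantCoeff g) := by
        rw [X_dvd_iff]; simp
      have hg : g = C (constantCoeff g) + X * g1 := by rw [← hg1]; ring
      have hC : ∀ c : F, σ (C c) = C c := fun c => σ.commutes c
      have e : σ g - g = X * (σ g1 - g1) + (σ X - X) * σ g1 := by
        rw [hg, map_add, hC, map_mul]; ring
      rw [e]
      refine dvd_add ?_ (Dvd.dvd.mul_right ((pow_dvd_pow X ht).trans h) _)
      rw [pow_succ']
      exact mul_dvd_mul_left X (ih (by omega) g1)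
  exact key _ le_rfl g

lemma nt_gen {i : ℕ} {σ : F⟦X⟧ ≃ₐ[F] F⟦X⟧} (h : (X : F⟦X⟧) ^ (i + 1) ∣ σ X - X) {k : ℕ}
    {g : F⟦X⟧} (hg : X ^ k ∣ g) : X ^ (k + i) ∣ σ g - g := by
  obtain ⟨g, rfl⟩ := hg
  have e : σ (X ^ k * g) - X ^ k * g = σ (X ^ k) * (σ g - g) + (σ (X ^ k) - X ^ k) * g := by
    rw [map_mul]; ring
  rw [e]
  refine dvd_add ?_ (Dvd.dvd.mul_right ?_ _)
  · rw [pow_add]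
    exact mul_dvd_mul (nt_pow_dvd σ dvd_rfl) ((pow_dvd_pow X (Nat.le_succ i)).trans (nt_base h g))
  · obtain ⟨r, hr⟩ := h
    have hX : σ X = X * (1 + X ^ i * r) := by
      have : σ X = X + X ^ (i + 1) * r := by rw [← hr]; ring
      rw [this]; ring
    rw [map_pow, hX, mul_pow, pow_add]
    have : X ^ k * (1 + X ^ i * r) ^ k - X ^ k = X ^ k * ((1 + X ^ i * r) ^ k - 1 ^ k) := by
      rw [one_pow]; ring
    rw [this]
    refine mul_dvd_mul_left _ (Dvd.dvd.trans ?_ (sub_dvd_pow_sub_pow _ _ k))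
    simp

lemma nt_mem_gen {i : ℕ} {σ : NottinghamGroup F} (h : σ ∈ NottinghamCong F i) {k : ℕ}
    {g : F⟦X⟧} (hg : X ^ k ∣ g) : X ^ (k + i) ∣ σ.1 g - g := nt_gen (nt_mem.1 h) hg

lemma nt_mem_one (σ : NottinghamGroup F) : σ ∈ NottinghamCong F 1 := σ.2

lemma nt_anti {m n : ℕ} (h : m ≤ n) : NottinghamCong F n ≤ NottinghamCong F m := by
  intro σ hσ
  rw [nt_mem] at hσ ⊢
  exact (pow_dvd_pow X (by omega)).trans hσ

/-- congruence criterion -/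
lemma nt_congr {r : ℕ} {σ τ : NottinghamGroup F} :
    σ⁻¹ * τ ∈ NottinghamCong F r ↔ (X : F⟦X⟧) ^ (r + 1) ∣ τ.1 X - σ.1 X := by
  rw [nt_mem]
  have e : (σ⁻¹ * τ).1 X - X = σ.1.symm (τ.1 X - σ.1 X) := by
    rw [map_sub, AlgEquiv.symm_apply_apply]; rfl
  rw [e]
  constructor
  · intro h
    have := nt_pow_dvd σ.1 h
    rwa [AlgEquiv.apply_symm_apply] at this
  · exact nt_pow_dvd _

instance nt_normal (n : ℕ) : (NottinghamCong F n).Normal := by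
  constructor
  intro k hk g
  have : (g⁻¹)⁻¹ * (k * g⁻¹) ∈ NottinghamCong F n := by
    rw [nt_congr]
    have := nt_mem_gen hk (k := 1) (g := (g⁻¹).1 X) (by
      simpa using X_dvd_algEquiv_X (g⁻¹).1)
    rwa [add_comm 1 n] at this
  simpa [mul_assoc] using this

/-- commutator expansion -/
lemma nt_comm_eq (a b : NottinghamGroup F) (f : F⟦X⟧) :
    a.1 (b.1 f) - b.1 (a.1 f) =
      (a.1 (b.1 f - f) - (b.1 f - f)) - (b.1 (a.1 f - f) - (a.1 f - f)) := by
  simp only [map_sub]; ring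

lemma nt_comm_dvd {i j : ℕ} {a b : NottinghamGroup F} (ha : a ∈ NottinghamCong F i)
    (hb : b ∈ NottinghamCong F j) {k : ℕ} {f : F⟦X⟧} (hf : X ^ k ∣ f) :
    X ^ (k + (i + j)) ∣ a.1 (b.1 f) - b.1 (a.1 f) := by
  rw [nt_comm_eq]
  refine dvd_sub ?_ ?_
  · have := nt_mem_gen ha (nt_mem_gen hb hf)
    rwa [show k + j + i = k + (i + j) by ring] at this
  · have := nt_mem_gen hb (nt_mem_gen ha hf)
    rwa [show k + i + j = k + (i + j) by ring] at this

lemma nt_comm_val (a b : NottinghamGroup F) :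
    (a * b * a⁻¹ * b⁻¹).1 X - X = a.1 (b.1 ((b * a)⁻¹.1 X)) - b.1 (a.1 ((b * a)⁻¹.1 X)) := by
  have h2 : b.1 (a.1 ((b * a)⁻¹.1 X)) = (X : F⟦X⟧) := by
    change (b * a * (b * a)⁻¹).1 X = X
    rw [mul_inv_cancel]; rfl
  have h1 : (a * b * a⁻¹ * b⁻¹).1 X = a.1 (b.1 ((b * a)⁻¹.1 X)) := by
    rw [mul_inv_rev]; rfl
  rw [h1, h2]

lemma nt_comm_mem {i j : ℕ} {a b : NottinghamGroup F} (ha : a ∈ NottinghamCong F i)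
    (hb : b ∈ NottinghamCong F j) : a * b * a⁻¹ * b⁻¹ ∈ NottinghamCong F (i + j) := by
  rw [nt_mem, nt_comm_val]
  have := nt_comm_dvd ha hb (k := 1) (f := (b * a)⁻¹.1 X) (by
      simpa using X_dvd_algEquiv_X ((b * a)⁻¹).1)
  rwa [add_comm 1] at this

/-- leading term of the commutator -/
lemma nt_comm_lead {i j m : ℕ} {a b : NottinghamGroup F} (ha : a ∈ NottinghamCong F i)
    (hb : b ∈ NottinghamCong F j) (hi : m ≤ i) (hj : m ≤ j) :
    X ^ (i + j + m + 1) ∣ ((a * b * a⁻¹ * b⁻¹).1 X - X) - (a.1 (b.1 X) - b.1 (a.1 X)) := by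
  rw [nt_comm_val]
  have hc : (b * a)⁻¹ ∈ NottinghamCong F m :=
    inv_mem (mul_mem (nt_anti hj hb) (nt_anti hi ha))
  have h := nt_comm_dvd ha hb (nt_mem.1 hc)
  rw [show m + 1 + (i + j) = i + j + m + 1 by ring] at h
  convert h using 1
  simp only [map_sub]
  ring

/-- existence of automorphisms -/
lemma nt_exists {i : ℕ} (hi : 1 ≤ i) {f : F⟦X⟧} (hf : X ^ (i + 1) ∣ f) :
    ∃ a : NottinghamGroup F, a ∈ NottinghamCong F i ∧ a.1 X = X + f := by
  have hf2 : (X : F⟦X⟧) ^ 2 ∣ f := (pow_dvd_pow X (by omega)).trans hf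
  have hc := X_pow_dvd_iff.1 hf2
  have h0 : constantCoeff (X + f) = 0 := by
    have := hc 0 (by norm_num)
    simpa using this
  have h1 : coeff 1 (X + f) = 1 := by
    have := hc 1 (by norm_num)
    simp [this]
  have hu : IsUnit (coeff 1 (X + f)) := by rw [h1]; exact isUnit_one
  set P := X + f with hP
  have hPs : HasSubst P := HasSubst.of_constantCoeff_zero' h0
  set Q := P.substInvOfIsUnit hu with hQ
  have hQs : HasSubst Q := HasSubst.substInvOfIsUnit P hu
  have e1 : P.subst Q = X := subst_substInvOfIsUnit_right P h0 hu
  have e2 : Q.subst P = X := subst_substInvOfIsUnit_left P h0 hu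
  let σ : F⟦X⟧ ≃ₐ[F] F⟦X⟧ := AlgEquiv.ofAlgHom (substAlgHom hPs) (substAlgHom hQs)
    (by
      ext1 g
      simp only [AlgHom.comp_apply, coe_substAlgHom, AlgHom.id_apply]
      rw [subst_comp_subst_apply hQs hPs, e2, X_subst])
    (by
      ext1 g
      simp only [AlgHom.comp_apply, coe_substAlgHom, AlgHom.id_apply]
      rw [subst_comp_subst_apply hPs hQs, e1, X_subst])
  have hσ : σ X = X + f := by
    change substAlgHom hPs X = _
    rw [coe_substAlgHom, subst_X hPs]
  refine ⟨⟨σ, ?_⟩, ?_, hσ⟩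
  · change σ X - X ∈ Ideal.span {(X : F⟦X⟧) ^ 2}
    rw [Ideal.mem_span_singleton, hσ]
    simpa using hf2
  · rw [nt_mem]
    change X ^ (i + 1) ∣ σ X - X
    rw [hσ]
    simpa using hf

/-- Explicit commutator with `X ↦ X + X^(j+1)`. -/
lemma nt_comm_explicit {i j m M : ℕ} (hm : 1 ≤ m) (hi : m ≤ i) (hj : m ≤ j) (c : ℕ → F) :
    ∃ a b : NottinghamGroup F, a ∈ NottinghamCong F m ∧ b ∈ NottinghamCong F m ∧
      X ^ (i + j + m + 1) ∣ ((a * b * a⁻¹ * b⁻¹).1 X - X) -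
        ∑ s ∈ Finset.range M, C (c s * ((j : F) - ((i + s : ℕ) : F))) * X ^ (i + j + 1 + s) ∧
      a * b * a⁻¹ * b⁻¹ ∈ NottinghamCong F (i + j) := by
  set f0 : F⟦X⟧ := ∑ s ∈ Finset.range M, C (c s) * X ^ s with hf0
  obtain ⟨a, ha, haX⟩ := nt_exists (i := i) (by omega) (f := X ^ (i + 1) * f0) (dvd_mul_right _ _)
  obtain ⟨b, hb, hbX⟩ := nt_exists (F := F) (i := j) (by omega) (f := X ^ (j + 1)) dvd_rfl
  refine ⟨a, b, nt_anti hi ha, nt_anti hj hb, ?_, nt_comm_mem ha hb⟩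
  have hlead := nt_comm_lead ha hb hi hj
  have hdiff : a.1 (b.1 X) - b.1 (a.1 X) =
      (a.1 (X ^ (j + 1)) - X ^ (j + 1)) - (b.1 (X ^ (i + 1) * f0) - X ^ (i + 1) * f0) := by
    rw [hbX, haX, map_add, map_add, hbX, haX]; ring
  -- first term
  have t1 : X ^ (i + j + m + 1) ∣ (a.1 (X ^ (j + 1)) - X ^ (j + 1)) -
      ((j + 1 : ℕ) : F⟦X⟧) * X ^ (i + j + 1) * f0 := by
    obtain ⟨r, hr⟩ := Polynomial.powAddExpansion (1 : F⟦X⟧) (X ^ i * f0) (j + 1)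
    have e : (a.1 (X ^ (j + 1)) - X ^ (j + 1)) - ((j + 1 : ℕ) : F⟦X⟧) * X ^ (i + j + 1) * f0 =
        X ^ (j + 1 + 2 * i) * (r * f0 ^ 2) := by
      rw [map_pow, haX, show X + X ^ (i + 1) * f0 = X * (1 + X ^ i * f0) by ring, mul_pow, hr]
      simp only [one_pow]
      ring
    rw [e]
    exact Dvd.dvd.mul_right (pow_dvd_pow X (by omega)) _
  -- second term
  have t2 : X ^ (i + j + m + 1) ∣ (b.1 (X ^ (i + 1) * f0) - X ^ (i + 1) * f0) -
      ∑ s ∈ Finset.range M, C (c s) * ((i + s + 1 : ℕ) : F⟦X⟧) * X ^ (i + j + 1 + s) := by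
    have hC : ∀ c : F, b.1 (C c) = C c := fun c => b.1.commutes c
    rw [hf0, Finset.mul_sum, map_sum, ← Finset.sum_sub_distrib, ← Finset.sum_sub_distrib]
    apply Finset.dvd_sum
    intro s _
    obtain ⟨r, hr⟩ := Polynomial.powAddExpansion (1 : F⟦X⟧) (X ^ j) (i + s + 1)
    have e : b.1 (X ^ (i + 1) * (C (c s) * X ^ s)) - X ^ (i + 1) * (C (c s) * X ^ s) -
        C (c s) * ((i + s + 1 : ℕ) : F⟦X⟧) * X ^ (i + j + 1 + s) =
        X ^ (i + s + 1 + 2 * j) * (C (c s) * r) := by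
      rw [show X ^ (i + 1) * (C (c s) * X ^ s) = C (c s) * X ^ (i + s + 1) by ring,
        map_mul, hC, map_pow, hbX, show X + X ^ (j + 1) = (X : F⟦X⟧) * (1 + X ^ j) by ring,
        mul_pow, hr]
      simp only [one_pow]
      ring
    rw [e]
    exact Dvd.dvd.mul_right (pow_dvd_pow X (by omega)) _
  have e3 : ∑ s ∈ Finset.range M, C (c s * ((j : F) - ((i + s : ℕ) : F))) * X ^ (i + j + 1 + s) =
      ((j + 1 : ℕ) : F⟦X⟧) * X ^ (i + j + 1) * f0 -
      ∑ s ∈ Finset.range M, C (c s) * ((i + s + 1 : ℕ) : F⟦X⟧) * X ^ (i + j + 1 + s) := by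
    rw [hf0, Finset.mul_sum, ← Finset.sum_sub_distrib]
    apply Finset.sum_congr rfl
    intro s _
    simp only [map_mul, map_sub, map_natCast]
    push_cast
    ring
  rw [hdiff] at hlead
  have := dvd_add hlead (dvd_sub t1 t2)
  rw [e3]
  convert this using 1
  ring

/-- Every element of `K_n` is a product of two commutators modulo `K_{n+m}`. -/
lemma nt_two_comm (h2 : (2 : F) ≠ 0) {m n : ℕ} (hm : 1 ≤ m) (hn : 2 * m + 1 ≤ n)
    {g : NottinghamGroup F} (hg : g ∈ NottinghamCong F n) :
    ∃ a b a' b' : NottinghamGroup F, a ∈ NottinghamCong F m ∧ b ∈ NottinghamCong F m ∧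
      a' ∈ NottinghamCong F m ∧ b' ∈ NottinghamCong F m ∧
      ((a * b * a⁻¹ * b⁻¹) * (a' * b' * a'⁻¹ * b'⁻¹))⁻¹ * g ∈ NottinghamCong F (n + m) := by
  classical
  set i := n - m with hi
  have hin : i + m = n := by omega
  have hin' : (i - 1) + (m + 1) = n := by omega
  -- coefficients of the target
  set G : ℕ → F := fun s => coeff (n + 1 + s) (g.1 X - X) with hG
  set u : ℕ → F := fun s => (m : F) - ((i + s : ℕ) : F) with hu
  set v : ℕ → F := fun s => ((m + 1 : ℕ) : F) - ((i - 1 + s : ℕ) : F) with hv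
  have huv : ∀ s, v s = u s + 2 := by
    intro s
    simp only [hu, hv]
    obtain ⟨k, hk⟩ : ∃ k, i = k + 1 := ⟨i - 1, by omega⟩
    rw [hk, Nat.add_sub_cancel]
    push_cast
    ring
  set c : ℕ → F := fun s => if u s = 0 then 0 else G s / u s with hc
  set d : ℕ → F := fun s => if u s = 0 then G s / 2 else 0 with hd
  have hcd : ∀ s, c s * u s + d s * v s = G s := by
    intro s
    simp only [hc, hd, huv]
    by_cases h : u s = 0
    · simp [h, h2]
    · simp [h]
  obtain ⟨a, b, ha, hb, h1, h1'⟩ := nt_comm_explicit (M := m) hm (i := i) (by omega) le_rfl c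
  obtain ⟨a', b', ha', hb', h3, h3'⟩ :=
    nt_comm_explicit (M := m) hm (i := i - 1) (j := m + 1) (by omega) (by omega) d
  rw [hin] at h1 h1'
  rw [hin'] at h3 h3'
  refine ⟨a, b, a', b', ha, hb, ha', hb', ?_⟩
  rw [nt_congr]
  set w := a * b * a⁻¹ * b⁻¹
  set w' := a' * b' * a'⁻¹ * b'⁻¹
  have htgt : X ^ (n + m + 1) ∣ (g.1 X - X) -
      ∑ s ∈ Finset.range m, C (G s) * X ^ (n + 1 + s) := by
    rw [X_pow_dvd_iff]
    intro k hk
    rw [map_sub, map_sum]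
    simp only [coeff_C_mul, coeff_X_pow]
    by_cases hkn : k < n + 1
    · rw [X_pow_dvd_iff.1 (nt_mem.1 hg) k hkn, Finset.sum_eq_zero, sub_zero]
      intro s _
      rw [if_neg (by omega), mul_zero]
    · rw [Finset.sum_eq_single (k - (n + 1))]
      · have : n + 1 + (k - (n + 1)) = k := by omega
        simp only [hG, this]
        simp
      · intro s _ hs
        rw [if_neg (by omega), mul_zero]
      · intro h
        exfalso
        apply h
        rw [Finset.mem_range]
        omega
  have hsum : ∑ s ∈ Finset.range m, C (G s) * X ^ (n + 1 + s) =
      ∑ s ∈ Finset.range m, C (c s * u s) * X ^ (n + 1 + s) +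
      ∑ s ∈ Finset.range m, C (d s * v s) * (X : F⟦X⟧) ^ (n + 1 + s) := by
    rw [← Finset.sum_add_distrib]
    apply Finset.sum_congr rfl
    intro s _
    rw [← hcd, map_add, add_mul]
  have hmul : X ^ (n + m + 1) ∣ w.1 (w'.1 X - X) - (w'.1 X - X) :=
    (pow_dvd_pow X (by omega)).trans (nt_mem_gen h1' (nt_mem.1 h3'))
  have hww : (w * w').1 X = w.1 (w'.1 X) := rfl
  rw [hww]
  rw [hsum] at htgt
  have := dvd_sub (dvd_sub htgt hmul) (dvd_add h1 h3)
  convert this using 1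
  rw [map_sub]
  ring

/-- commutators of approximations -/
lemma nt_comm_approx {m n : ℕ} {a b a' b' : NottinghamGroup F} (hmn : m ≤ n)
    (ha : a ∈ NottinghamCong F m)
    (hb : b ∈ NottinghamCong F m) (haa : a'⁻¹ * a ∈ NottinghamCong F n)
    (hbb : b'⁻¹ * b ∈ NottinghamCong F n) :
    (a' * b' * a'⁻¹ * b'⁻¹)⁻¹ * (a * b * a⁻¹ * b⁻¹) ∈ NottinghamCong F (n + m) := by
  -- work in the quotient
  have hb' : b' ∈ NottinghamCong F m := by
    have := mul_mem hb (inv_mem (nt_anti hmn hbb))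
    simpa using this
  obtain ⟨x, hx⟩ : ∃ x, x = a'⁻¹ * a := ⟨_, rfl⟩
  obtain ⟨y, hy⟩ : ∃ y, y = b'⁻¹ * b := ⟨_, rfl⟩
  rw [← hx] at haa
  rw [← hy] at hbb
  have ea : a' = a * x⁻¹ := by rw [hx]; group
  have eb : b = b' * y := by rw [hy]; group
  have hxb := nt_comm_mem (inv_mem haa) hb'
  have hya := nt_comm_mem ha hbb
  rw [add_comm] at hya
  rw [← QuotientGroup.eq_one_iff] at hxb hya ⊢
  -- in the quotient `x` commutes with `b'` and `y` commutes with `a`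
  subst ea eb
  simp only [QuotientGroup.mk_mul, QuotientGroup.mk_inv, inv_inv, mul_inv_rev] at hxb hya ⊢
  generalize (a : NottinghamGroup F ⧸ NottinghamCong F (n + m)) = A at *
  generalize (b' : NottinghamGroup F ⧸ NottinghamCong F (n + m)) = B at *
  generalize (x : NottinghamGroup F ⧸ NottinghamCong F (n + m)) = U at *
  generalize (y : NottinghamGroup F ⧸ NottinghamCong F (n + m)) = V at *
  have c1 : U⁻¹ * B * U = B := by
    rw [mul_inv_eq_one] at hxb; exact hxb
  have c2 : V * A⁻¹ * V⁻¹ = A⁻¹ := by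
    have : A * (V * A⁻¹ * V⁻¹) = 1 := by simpa [mul_assoc] using hya
    exact (inv_eq_of_mul_eq_one_right this).symm
  have e1 : A * U⁻¹ * B * (U * A⁻¹) * B⁻¹ = A * B * A⁻¹ * B⁻¹ := by
    calc _ = A * (U⁻¹ * B * U) * A⁻¹ * B⁻¹ := by group
      _ = _ := by rw [c1]
  have e2 : A * (B * V) * A⁻¹ * (V⁻¹ * B⁻¹) = A * B * A⁻¹ * B⁻¹ := by
    calc _ = A * B * (V * A⁻¹ * V⁻¹) * B⁻¹ := by group
      _ = _ := by rw [c2]; 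
  rw [e2]
  calc _ = (A * U⁻¹ * B * (U * A⁻¹) * B⁻¹)⁻¹ * (A * B * A⁻¹ * B⁻¹) := by group
    _ = 1 := by rw [e1]; group

end NottAlg
section NottDiam

open scoped Pointwise

variable {F : Type*} [Field F]

/-- words of length `l` in `T` cover the quotient by `K_n` -/
def ntCov (T : Set (NottinghamGroup F)) (l n : ℕ) : Prop :=
  ∀ g : NottinghamGroup F, ∃ w ∈ T ^ l, w⁻¹ * g ∈ NottinghamCong F n

lemma nt_inv_pow {T : Set (NottinghamGroup F)} (hT : ∀ t ∈ T, t⁻¹ ∈ T) (l : ℕ)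
    {w : NottinghamGroup F} (hw : w ∈ T ^ l) : w⁻¹ ∈ T ^ l := by
  have h : T⁻¹ = T := by
    ext t
    rw [Set.mem_inv]
    exact ⟨fun h => by simpa using hT _ h, hT t⟩
  rw [← h, inv_pow, Set.mem_inv, inv_inv]
  exact hw

lemma ntCov_step (h2 : (2 : F) ≠ 0) {T : Set (NottinghamGroup F)} (hT : ∀ t ∈ T, t⁻¹ ∈ T)
    {l m n : ℕ} (hm : 1 ≤ m) (hn : 2 * m + 1 ≤ n) (h : ntCov T l n) :
    ntCov T (9 * l) (n + m) := by
  intro g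
  obtain ⟨w, hw, hwg⟩ := h g
  obtain ⟨a, b, c, d, ha, hb, hc, hd, hk⟩ := nt_two_comm h2 hm hn hwg
  obtain ⟨a', ha', haa⟩ := h a
  obtain ⟨b', hb', hbb⟩ := h b
  obtain ⟨c', hc', hcc⟩ := h c
  obtain ⟨d', hd', hdd⟩ := h d
  have k1 := nt_comm_approx (by omega) ha hb haa hbb
  have k2 := nt_comm_approx (by omega) hc hd hcc hdd
  refine ⟨w * (a' * b' * a'⁻¹ * b'⁻¹) * (c' * d' * c'⁻¹ * d'⁻¹), ?_, ?_⟩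
  · have e : 9 * l = l + (l + l + l + l) + (l + l + l + l) := by ring
    rw [e]
    simp only [pow_add]
    exact Set.mul_mem_mul (Set.mul_mem_mul hw (Set.mul_mem_mul (Set.mul_mem_mul
      (Set.mul_mem_mul ha' hb') (nt_inv_pow hT l ha')) (nt_inv_pow hT l hb')))
      (Set.mul_mem_mul (Set.mul_mem_mul
      (Set.mul_mem_mul hc' hd') (nt_inv_pow hT l hc')) (nt_inv_pow hT l hd'))
  · rw [← QuotientGroup.eq] at k1 k2 hk ⊢
    rw [QuotientGroup.mk_mul, QuotientGroup.mk_mul, k1, k2, mul_assoc, ← QuotientGroup.mk_mul, hk,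
      ← QuotientGroup.mk_mul]
    congr 1
    group

lemma ntCov_anti {T : Set (NottinghamGroup F)} {l n n' : ℕ} (hn : n' ≤ n) (h : ntCov T l n) :
    ntCov T l n' := by
  intro g
  obtain ⟨w, hw, hwg⟩ := h g
  exact ⟨w, hw, nt_anti hn hwg⟩

lemma ntCov_double (h2 : (2 : F) ≠ 0) {T : Set (NottinghamGroup F)} (hT : ∀ t ∈ T, t⁻¹ ∈ T)
    {l n : ℕ} (hn : 9 ≤ n) (h : ntCov T l n) : ntCov T (729 * l) (2 * n) := by
  have s1 := ntCov_step h2 hT (m := (n - 1) / 2) (by omega) (by omega) h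
  have s2 := ntCov_step h2 hT (m := (n - 1) / 2) (by omega) (by omega) s1
  have s3 := ntCov_step h2 hT (m := (n - 1) / 2) (by omega) (by omega) s2
  have := ntCov_anti (n' := 2 * n) (by omega) s3
  rwa [show 9 * (9 * (9 * l)) = 729 * l by ring] at this

lemma ntCov_iter (h2 : (2 : F) ≠ 0) {T : Set (NottinghamGroup F)} (hT : ∀ t ∈ T, t⁻¹ ∈ T)
    {l : ℕ} (h : ntCov T l 9) (k : ℕ) : ntCov T (729 ^ k * l) (2 ^ k * 9) := by
  induction k with
  | zero => simpa using h
  | succ k ih =>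
    have := ntCov_double h2 hT (by have := Nat.one_le_two_pow (n := k); omega) ih
    rw [pow_succ, pow_succ]
    rwa [show 729 * (729 ^ k * l) = 729 ^ k * 729 * l by ring,
      show 2 * (2 ^ k * 9) = 2 ^ k * 2 * 9 by ring] at this

lemma nt_mono {T : Set (NottinghamGroup F)} (h1 : (1 : NottinghamGroup F) ∈ T) {l l' : ℕ}
    (h : l ≤ l') : T ^ l ⊆ T ^ l' := Set.pow_subset_pow_right h1 h

/-- polynomial diameter bound -/
lemma ntCov_poly (h2 : (2 : F) ≠ 0) {T : Set (NottinghamGroup F)} (hT : ∀ t ∈ T, t⁻¹ ∈ T)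
    (h1 : (1 : NottinghamGroup F) ∈ T) {l : ℕ} (h : ntCov T l 9) (n : ℕ) (hn : 1 ≤ n) :
    ntCov T ((l + 1) * 1024 * n ^ 10) n := by
  set k := Nat.log 2 n + 1 with hk
  have hlt : n < 2 ^ k := Nat.lt_pow_succ_log_self (by norm_num) n
  have hle : 2 ^ k ≤ 2 * n := by
    rw [hk, pow_succ, mul_comm]
    exact Nat.mul_le_mul_left 2 (Nat.pow_log_le_self 2 (by omega))
  intro g
  obtain ⟨w, hw, hwg⟩ := ntCov_iter h2 hT h k g
  refine ⟨w, nt_mono h1 ?_ hw, nt_anti (by omega) hwg⟩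
  calc 729 ^ k * l ≤ 1024 ^ k * (l + 1) :=
        Nat.mul_le_mul (Nat.pow_le_pow_left (by norm_num) k) (by omega)
    _ = (2 ^ k) ^ 10 * (l + 1) := by
        rw [show 1024 = 2 ^ 10 by norm_num, ← pow_mul, ← pow_mul, mul_comm 10 k]
    _ ≤ (2 * n) ^ 10 * (l + 1) := Nat.mul_le_mul_right _ (Nat.pow_le_pow_left hle 10)
    _ = _ := by rw [mul_pow]; ring

/-- quotients are finite -/
instance nt_finite [Finite F] (n : ℕ) : Finite (NottinghamGroup F ⧸ NottinghamCong F n) := by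
  refine Finite.of_injective
    (fun (x : NottinghamGroup F ⧸ NottinghamCong F n) (i : Fin (n + 1)) =>
      coeff (i : ℕ) ((Quotient.out x).1 X)) ?_
  intro x y hxy
  rw [← QuotientGroup.out_eq' x, ← QuotientGroup.out_eq' y, QuotientGroup.eq, nt_congr,
    X_pow_dvd_iff]
  intro m hm
  have := congrFun hxy ⟨m, hm⟩
  simp only at this
  rw [map_sub, sub_eq_zero]
  exact this.symm

lemma nt_pow_char {p : ℕ} (hp : (p : F) = 0) {i : ℕ} (hi : 1 ≤ i) {σ : NottinghamGroup F}
    (h : σ ∈ NottinghamCong F i) : σ ^ p ∈ NottinghamCong F (i + 1) := by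
  have key : ∀ k : ℕ, X ^ (i + 1 + 1) ∣ ((σ ^ k).1 X - X) - (k : F⟦X⟧) * (σ.1 X - X) := by
    intro k
    induction k with
    | zero => simp
    | succ k ih =>
      have hk := nt_mem.1 (pow_mem h k)
      have h1 : X ^ (i + 1 + 1) ∣ σ.1 ((σ ^ k).1 X - X) - ((σ ^ k).1 X - X) :=
        (pow_dvd_pow X (by omega)).trans (nt_mem_gen h hk)
      have e : (σ ^ (k + 1)).1 X = σ.1 ((σ ^ k).1 X) := by rw [pow_succ']; rfl
      have := dvd_add h1 ih
      rw [e]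
      convert this using 1
      rw [map_sub]
      push_cast
      ring
  have := key p
  rw [nt_mem]
  have hp' : (p : F⟦X⟧) = 0 := by
    have : (p : F⟦X⟧) = C (p : F) := by simp
    rw [this, hp, map_zero]
  simpa [hp'] using this

lemma nt_pow_char_iter {p : ℕ} (hp : (p : F) = 0) (σ : NottinghamGroup F) (k : ℕ) :
    σ ^ (p ^ k) ∈ NottinghamCong F (k + 1) := by
  induction k with
  | zero => simpa using nt_mem_one σ
  | succ k ih =>
    rw [pow_succ, pow_mul]
    exact nt_pow_char hp (by omega) ih

lemma nt_cov_base [Finite F] {p : ℕ} (hp : (p : F) = 0) (hodd : Odd p)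
    (S : Set (NottinghamGroup F)) (hsym : ∀ s ∈ S, s⁻¹ ∈ S) (n : ℕ)
    (hgen : Subgroup.closure S ⊔ NottinghamCong F (n + 1) = ⊤)
    {T : Set (NottinghamGroup F)} (hTS : ∀ s ∈ S, s * s ∈ T)
    (h1 : (1 : NottinghamGroup F) ∈ T) (hT : ∀ t ∈ T, t⁻¹ ∈ T) :
    ∃ l, ntCov T l (n + 1) := by
  have hgen' : Subgroup.closure T ⊔ NottinghamCong F (n + 1) = ⊤ := by
    rw [eq_top_iff, ← hgen]
    refine sup_le ?_ le_sup_right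
    rw [Subgroup.closure_le]
    intro s hs
    obtain ⟨m, hm⟩ := hodd.pow (n := n)
    have hk := nt_pow_char_iter hp s n
    have hss : s * s ∈ Subgroup.closure T := Subgroup.subset_closure (hTS s hs)
    have e : s = ((s * s) ^ m)⁻¹ * s ^ (p ^ n) := by
      rw [hm, ← sq, ← pow_mul, pow_succ]; group
    rw [e]
    exact mul_mem (le_sup_left (a := Subgroup.closure T) (inv_mem (pow_mem hss m)))
      (le_sup_right (a := Subgroup.closure T) hk)
  have hex : ∀ x : NottinghamGroup F ⧸ NottinghamCong F (n + 1),
      ∃ l, ∃ w ∈ T ^ l, (w : NottinghamGroup F ⧸ NottinghamCong F (n + 1)) = x := by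
    intro x
    obtain ⟨g, rfl⟩ := QuotientGroup.mk_surjective x
    have hg : g ∈ Subgroup.closure T ⊔ NottinghamCong F (n + 1) := by rw [hgen']; trivial
    obtain ⟨w, hw, k, hk, rfl⟩ := Subgroup.mem_sup_of_normal_right.1 hg
    have : ∃ l, w ∈ T ^ l := by
      induction hw using Subgroup.closure_induction with
      | mem x hx => exact ⟨1, by simpa using hx⟩
      | one => exact ⟨0, by simp⟩
      | mul x y _ _ hx hy =>
        obtain ⟨l, hl⟩ := hx (by rw [hgen']; trivial)
        obtain ⟨l', hl'⟩ := hy (by rw [hgen']; trivial)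
        exact ⟨l + l', by rw [pow_add]; exact Set.mul_mem_mul hl hl'⟩
      | inv x _ hx =>
        obtain ⟨l, hl⟩ := hx (by rw [hgen']; trivial)
        exact ⟨l, nt_inv_pow hT l hl⟩
    obtain ⟨l, hl⟩ := this
    refine ⟨l, w, hl, ?_⟩
    rw [QuotientGroup.eq]
    simpa using hk
  choose L w hw hwx using hex
  obtain ⟨B, hB⟩ := (Set.finite_range L).bddAbove
  refine ⟨B, fun g => ⟨w g, nt_mono h1 (hB ⟨_, rfl⟩) (hw g), ?_⟩⟩
  rw [← QuotientGroup.eq]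
  exact hwx g

end NottDiam
open Classical in
/-- **Corollary 1.10 (mixing of random walks on congruence quotients of the
Nottingham group).**  Let `p ≥ 3` be a prime, `q` a power of `p`, `F` a finite
field with `q` elements, `N` the Nottingham group of `F` with congruence
subgroups `K_n`, and `S ⊆ N` a finite symmetric set whose image generates each
finite quotient `N/K_n`.  Then there is `C > 0` such that for every `C' > 0`
there are `C'', C''' > 0`: for every `n ≥ 2`, every element of `N/K_n`
(represented by `g ∈ N`) and every `l ≥ C''·n^{C+C'}`, the law `ν^{*l}` of the
simple random walk at time `l` (here expressed as the probability that a product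
of `l` uniformly random elements of `S` lands in the coset of `g`) satisfies
`|ν^{*l}(gK_n) − 1/|N/K_n|| ≤ exp(−C'''·n^{C'})`. -/
theorem nottingham_random_walk_mixing
    (p q : ℕ) (hp : p.Prime) (hp3 : 3 ≤ p) (hq : ∃ k : ℕ, 0 < k ∧ q = p ^ k)
    (F : Type*) [Field F] [Fintype F] (hF : Fintype.card F = q)
    (S : Finset (NottinghamGroup F)) (hsym : ∀ s ∈ S, s⁻¹ ∈ S)
    (hgen : ∀ n, 1 ≤ n →
      Subgroup.closure (S : Set (NottinghamGroup F)) ⊔ NottinghamCong F n = ⊤) :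
    ∃ C : ℝ, 0 < C ∧ ∀ C' : ℝ, 0 < C' → ∃ C'' C''' : ℝ, 0 < C'' ∧ 0 < C''' ∧
      ∀ n : ℕ, 2 ≤ n → ∀ g : NottinghamGroup F, ∀ l : ℕ,
        C'' * (n : ℝ) ^ (C + C') ≤ (l : ℝ) →
        |(((Finset.univ.filter fun f : Fin l → S =>
              ((List.ofFn fun i => ((f i : NottinghamGroup F))).prod)⁻¹ * g ∈
                NottinghamCong F n).card : ℝ) / ((S.card : ℝ) ^ l)) -
            ((NottinghamCong F n).index : ℝ)⁻¹| ≤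
          Real.exp (-C''' * (n : ℝ) ^ C') := by
  classical
  obtain ⟨e, he, hqe⟩ := hq
  have hodd : Odd p := hp.odd_of_ne_two (by omega)
  have hp0 : (p : F) = 0 := by
    have h := FiniteField.cast_card_eq_zero F
    rw [hF, hqe, Nat.cast_pow] at h
    exact pow_eq_zero_iff (by omega) |>.1 h
  have h2 : (2 : F) ≠ 0 := by
    intro h
    obtain ⟨m, hm⟩ := hodd
    rw [hm] at hp0
    push_cast at hp0
    rw [h, zero_mul, zero_add] at hp0
    exact one_ne_zero hp0
  -- `S` is nonempty
  have hSne : S.Nonempty := by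
    rw [Finset.nonempty_iff_ne_empty]
    rintro rfl
    have h := hgen 2 (by norm_num)
    simp only [Finset.coe_empty, Subgroup.closure_empty, bot_sup_eq] at h
    obtain ⟨a, -, ha⟩ := nt_exists (F := F) (i := 1) le_rfl (f := X ^ 2) dvd_rfl
    have ha2 : a ∈ NottinghamCong F 2 := by rw [h]; trivial
    rw [nt_mem, ha, X_pow_dvd_iff] at ha2
    have := ha2 2 (by norm_num)
    simp [coeff_X_pow] at this
  obtain ⟨s0, hs0⟩ := hSne
  haveI : Nonempty S := ⟨⟨s0, hs0⟩⟩
  set T : Set (NottinghamGroup F) := {t | ∃ a b : S, t = (b.1)⁻¹ * a.1} with hTdef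
  have hT1 : (1 : NottinghamGroup F) ∈ T := ⟨⟨s0, hs0⟩, ⟨s0, hs0⟩, by simp⟩
  have hTi : ∀ t ∈ T, t⁻¹ ∈ T := by
    rintro _ ⟨a, b, rfl⟩
    exact ⟨b, a, by simp⟩
  have hTS : ∀ s ∈ (S : Set (NottinghamGroup F)), s * s ∈ T := by
    intro s hs
    exact ⟨⟨s, hs⟩, ⟨s⁻¹, hsym s hs⟩, by simp⟩
  obtain ⟨L, hL⟩ := nt_cov_base hp0 hodd (S : Set (NottinghamGroup F)) hsym 8
    (hgen 9 (by norm_num)) hTS hT1 hTi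
  have hcov := ntCov_poly h2 hTi hT1 hL
  set D : ℕ := (L + 1) * 1024 with hD
  have hDpos : (0 : ℝ) < D := by
    have : 0 < D := by omega
    exact_mod_cast this
  have hSpos : (0 : ℝ) < S.card := by
    have : 0 < S.card := Finset.card_pos.2 ⟨s0, hs0⟩
    exact_mod_cast this
  refine ⟨20, by norm_num, fun C' hC' => ⟨1, 1 / (2 * ((D : ℝ) ^ 2 * (S.card : ℝ) ^ 2)),
    one_pos, by positivity, ?_⟩⟩
  intro n hn g l hl
  have hn0 : (0 : ℝ) < n := by
    have : 0 < n := by omega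
    exact_mod_cast this
  letI : Fintype (NottinghamGroup F ⧸ NottinghamCong F n) := Fintype.ofFinite _
  let φ : S → NottinghamGroup F ⧸ NottinghamCong F n := fun s => ((s : NottinghamGroup F) : _)
  have hmain := wk_main φ (D * n ^ 10) (by positivity) (by
    intro x
    obtain ⟨g, rfl⟩ := QuotientGroup.mk_surjective x
    obtain ⟨w, hw, hwg⟩ := hcov n (by omega) g
    rw [← QuotientGroup.eq] at hwg
    rw [← hwg]
    have := Set.mem_image_of_mem (QuotientGroup.mk' (NottinghamCong F n)) hw
    rw [Set.image_pow] at this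
    refine Set.pow_subset_pow_left ?_ this
    rintro _ ⟨_, ⟨a, b, rfl⟩, rfl⟩
    exact ⟨a, b, rfl⟩) l (g : NottinghamGroup F ⧸ NottinghamCong F n)
  have hidx : ((NottinghamCong F n).index : ℝ) =
      (Fintype.card (NottinghamGroup F ⧸ NottinghamCong F n) : ℝ) := by
    rw [Subgroup.index, Nat.card_eq_fintype_card]
  have hP : wkP φ l (g : NottinghamGroup F ⧸ NottinghamCong F n) =
      (((Finset.univ.filter fun f : Fin l → S =>
              ((List.ofFn fun i => ((f i : NottinghamGroup F))).prod)⁻¹ * g ∈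
                NottinghamCong F n).card : ℝ) / ((S.card : ℝ) ^ l)) := by
    unfold wkP
    rw [Fintype.card_coe]
    congr 2
    congr 1
    ext f
    simp only [Finset.mem_filter, Finset.mem_univ, true_and]
    rw [← QuotientGroup.eq]
    have : ((List.ofFn fun i => ((f i : NottinghamGroup F))).prod :
        NottinghamGroup F ⧸ NottinghamCong F n) = (List.ofFn fun i => φ (f i)).prod := by
      rw [← QuotientGroup.coe_mk', map_list_prod, List.map_ofFn]
      rfl
    rw [this]
  rw [hP, ← hidx] at hmain
  refine hmain.trans (Real.exp_le_exp.2 ?_)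
  rw [neg_mul, neg_le_neg_iff, Fintype.card_coe]
  rw [one_mul, Real.rpow_add hn0] at hl
  have hl' : (n : ℝ) ^ 20 * (n : ℝ) ^ C' ≤ l := by
    have : (n : ℝ) ^ (20 : ℝ) = (n : ℝ) ^ (20 : ℕ) := by
      rw [← Real.rpow_natCast]; norm_num
    rwa [this] at hl
  push_cast
  rw [div_mul_eq_mul_div, one_mul, div_le_div_iff₀ (by positivity) (by positivity)]
  calc (n : ℝ) ^ C' * (2 * (((D : ℝ) * (n : ℝ) ^ 10) ^ 2 * (S.card : ℝ) ^ 2))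
      = ((n : ℝ) ^ 20 * (n : ℝ) ^ C') * (2 * ((D : ℝ) ^ 2 * (S.card : ℝ) ^ 2)) := by ring
    _ ≤ _ := by gcongr
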